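/- Let u : [0,∞) → [0,∞) be strictly increasing and continuous with liminf_{x→∞} u(x)/x > 0. Let h ∈ H and v ∈ V_u, and define b : ℝ⁴ → ℝ⁴ by b(x_1,x_2,x_3,x_4) = (0, ρ1(x_4), 0, 0) and a^{h,v} : ℝ⁴ → ℝ⁴ by a^{h,v}(x_1,x_2,x_3,x_4) = (ρ2(x_4)·ρ3((x_3/(1+x_3²))·v(x_2)), 0, h(x_4), 1). Then a^{h,v} and b are infinitely differentiable; |a^{h,v}(x)| ≤ 1 and |b(x)| ≤ 1 for all x ∈ ℝ⁴; |D^α b(x)| ≤ 1 for all x ∈ ℝ⁴ and all multi-indices α ∈ ℕ₀⁴ with |α|₁ ≤ 1; and |D^α a^{h,v}(x)| ≤ 1 + u(|x|) for all x ∈ ℝ⁴ and all multi-indices α ∈ ℕ₀⁴ with |α|₁ = 1, where |x| is the maximum norm on ℝ⁴. -/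

import Mathlib

open MeasureTheory

/-- The smooth transition function `θ_{τ1,τ2,v1,v2}`. -/
noncomputable def theta (τ1 τ2 v1 v2 : ℝ) (x : ℝ) : ℝ :=
  if x ≤ τ1 then v1
  else if x < τ2 then
    v1 + (v2 - v1) / (1 + Real.exp ((τ2 - τ1) / (x - τ1) - (τ2 - τ1) / (τ2 - x)))
  else v2

/-- `ρ1 = 1/8 - θ_{0,1/2,0,1/8}`. -/
noncomputable def rho1 (x : ℝ) : ℝ := 1 / 8 - theta 0 (1 / 2) 0 (1 / 8) x

/-- `ρ2 = θ_{1/2,1,0,1/8}`. -/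
noncomputable def rho2 (x : ℝ) : ℝ := theta (1 / 2) 1 0 (1 / 8) x

/-- `ρ3 x = x · exp (-x²)`. -/
noncomputable def rho3 (x : ℝ) : ℝ := x * Real.exp (-x ^ 2)

/-- The class `H` of smooth functions bounded by one, with derivative bounded by one,
supported in `[0,1/2]`. -/
def Hclass : Set (ℝ → ℝ) :=
  {h | ContDiff ℝ (⊤ : ℕ∞) h ∧ (∀ y, |h y| ≤ 1) ∧ (∀ y, |deriv h y| ≤ 1) ∧
    ∀ y, h y ≠ 0 → y ∈ Set.Icc (0 : ℝ) (1 / 2)}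

/-- The class `V_u`. -/
def Vu (u : ℝ → ℝ) : Set (ℝ → ℝ) :=
  {v | ContDiff ℝ (⊤ : ℕ∞) v ∧ ∀ y, |v y| ≤ 1 + u |y| ∧ |deriv v y| ≤ 1 + u |y|}

/-- The diffusion coefficient `b(x₁,x₂,x₃,x₄) = (0, ρ1(x₄), 0, 0)`. -/
noncomputable def bSDE : (Fin 4 → ℝ) → (Fin 4 → ℝ) :=
  fun x => ![0, rho1 (x 3), 0, 0]

/-- The drift coefficient
`a^{h,v}(x₁,x₂,x₃,x₄) = (ρ2(x₄)·ρ3((x₃/(1+x₃²))·v(x₂)), 0, h(x₄), 1)`. -/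
noncomputable def aSDE (h v : ℝ → ℝ) : (Fin 4 → ℝ) → (Fin 4 → ℝ) :=
  fun x => ![rho2 (x 3) * rho3 (x 2 / (1 + (x 2) ^ 2) * v (x 1)), 0, h (x 3), 1]


lemma aux_theta (d t1 t2 c : ℝ) (hd : 0 < d) (h12 : t2 - t1 = d) (x : ℝ) :
    theta t1 t2 0 c x = c * Real.smoothTransition ((x - t1) / d) := by
  unfold theta
  split_ifs with h1 h2
  · rw [Real.smoothTransition.zero_of_nonpos, mul_zero]
    exact div_nonpos_of_nonpos_of_nonneg (by linarith) hd.le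
  · have hx1 : 0 < x - t1 := by linarith [not_le.1 h1]
    have hx2 : 0 < t2 - x := by linarith
    have ha : 0 < (x - t1) / d := by positivity
    have hb : 1 - (x - t1) / d = (t2 - x) / d := by field_simp; linarith
    have hb' : 0 < (t2 - x) / d := by positivity
    unfold Real.smoothTransition expNegInvGlue
    rw [hb, if_neg (not_le.2 ha), if_neg (not_le.2 hb'), h12, sub_zero, zero_add, inv_div, inv_div,
      Real.exp_sub, Real.exp_neg, Real.exp_neg]
    have := Real.exp_pos (d / (x - t1))
    have := Real.exp_pos (d / (t2 - x))
    field_simp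
  · rw [Real.smoothTransition.one_of_one_le, mul_one]
    rw [le_div_iff₀ hd]; linarith

lemma aux_cosh (g : ℝ) : 4 + g ^ 2 ≤ 2 + Real.exp g + Real.exp (-g) := by
  have h1 : Real.cosh g = Real.cosh (g / 2) ^ 2 + Real.sinh (g / 2) ^ 2 := by
    rw [← Real.cosh_two_mul]; congr 1; ring
  have h2 := Real.cosh_sq (g / 2)
  have h3 : (g / 2) ^ 2 ≤ Real.sinh (g / 2) ^ 2 := by
    rcases le_total 0 (g / 2) with h | h
    · have := Real.self_le_sinh_iff.2 h
      nlinarith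
    · have := Real.sinh_le_self_iff.2 h
      nlinarith
  rw [Real.cosh_eq g] at h1
  nlinarith

lemma aux_st_deriv (t : ℝ) : |deriv Real.smoothTransition t| ≤ 4 := by
  by_cases h0 : t ≤ 0
  · have : IsLocalMin Real.smoothTransition t := by
      apply Filter.Eventually.of_forall
      intro y
      rw [Real.smoothTransition.zero_of_nonpos h0]
      exact Real.smoothTransition.nonneg y
    rw [this.deriv_eq_zero]; simp
  by_cases h1 : 1 ≤ t
  · have : IsLocalMax Real.smoothTransition t := by
      apply Filter.Eventually.of_forall
      intro y
      rw [Real.smoothTransition.one_of_one_le h1]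
      exact Real.smoothTransition.le_one y
    rw [this.deriv_eq_zero]; simp
  push Not at h0 h1
  have hs : 0 < 1 - t := by linarith
  have heq : Real.smoothTransition =ᶠ[nhds t]
      fun x => (1 + Real.exp (x⁻¹ - (1 - x)⁻¹))⁻¹ := by
    filter_upwards [Ioo_mem_nhds h0 h1] with x hx
    have hx1 : 0 < 1 - x := by linarith [hx.2]
    unfold Real.smoothTransition expNegInvGlue
    rw [if_neg (not_le.2 hx.1), if_neg (not_le.2 hx1), Real.exp_sub, Real.exp_neg, Real.exp_neg]
    have := Real.exp_pos (x⁻¹)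
    have := Real.exp_pos ((1 - x)⁻¹)
    field_simp
  rw [heq.deriv_eq]
  have hd : HasDerivAt (fun x : ℝ => (1 + Real.exp (x⁻¹ - (1 - x)⁻¹))⁻¹)
      (-(Real.exp (t⁻¹ - (1 - t)⁻¹) * (-(t ^ 2)⁻¹ - (-(-1) / (1 - t) ^ 2))) /
        (1 + Real.exp (t⁻¹ - (1 - t)⁻¹)) ^ 2) t := by
    have e1 := hasDerivAt_inv h0.ne'
    have e2 := ((hasDerivAt_id t).const_sub 1).inv (by simpa using hs.ne')
    exact ((((e1.sub e2).exp).const_add 1).inv (by positivity))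
  rw [hd.deriv]
  set a := t⁻¹ with ha
  set b := (1 - t)⁻¹ with hb
  have hapos : 0 < a := by positivity
  have hbpos : 0 < b := by positivity
  have hab : a * b = a + b := by rw [ha, hb]; field_simp; ring
  have hE := aux_cosh (a - b)
  rw [Real.exp_neg] at hE
  set E := Real.exp (a - b) with hEdef
  have hEpos : 0 < E := Real.exp_pos _
  have hval : -(E * (-(t ^ 2)⁻¹ - (-(-1) / (1 - t) ^ 2))) / (1 + E) ^ 2
      = E * (a ^ 2 + b ^ 2) / (1 + E) ^ 2 := by
    rw [ha, hb]; field_simp; ring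
  rw [hval, abs_of_nonneg (by positivity), div_le_iff₀ (by positivity)]
  have hp : 4 ≤ a + b := by
    nlinarith [sq_nonneg (a - b)]
  have key : a ^ 2 + b ^ 2 ≤ 4 * (2 + E + E⁻¹) := by
    nlinarith [mul_nonneg (by linarith : (0:ℝ) ≤ 3 * (a + b) - 8) (by linarith : (0:ℝ) ≤ a + b - 2)]
  calc E * (a ^ 2 + b ^ 2) ≤ E * (4 * (2 + E + E⁻¹)) := by gcongr
    _ = 4 * (1 + E) ^ 2 := by field_simp; ring

lemma aux_rho2_eq : rho2 = fun x => (1 / 8) * Real.smoothTransition ((x - 1 / 2) / (1 / 2)) := by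
  funext x
  exact aux_theta (1 / 2) (1 / 2) 1 (1 / 8) (by norm_num) (by norm_num) x

lemma aux_rho1_eq : rho1 = fun x => 1 / 8 - (1 / 8) * Real.smoothTransition ((x - 0) / (1 / 2)) := by
  funext x
  unfold rho1
  rw [aux_theta (1 / 2) 0 (1 / 2) (1 / 8) (by norm_num) (by norm_num) x]

lemma aux_rho2_smooth : ContDiff ℝ (⊤ : ℕ∞) rho2 := by
  rw [aux_rho2_eq]
  exact contDiff_const.mul (Real.smoothTransition.contDiff.comp
    ((contDiff_id.sub contDiff_const).div_const _))

lemma aux_rho1_smooth : ContDiff ℝ (⊤ : ℕ∞) rho1 := by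
  rw [aux_rho1_eq]
  exact contDiff_const.sub (contDiff_const.mul (Real.smoothTransition.contDiff.comp
    ((contDiff_id.sub contDiff_const).div_const _)))

lemma aux_scaled_deriv (t x : ℝ) : ∃ D : ℝ, |D| ≤ 1 ∧
    HasDerivAt (fun x => (1 / 8) * Real.smoothTransition ((x - t) / (1 / 2))) D x := by
  have e : HasDerivAt Real.smoothTransition (deriv Real.smoothTransition ((x - t) / (1 / 2)))
      ((x - t) / (1 / 2)) :=
    ((Real.smoothTransition.contDiff (n := 1)).differentiable (by norm_num) _).hasDerivAt
  have e2 : HasDerivAt (fun x : ℝ => (x - t) / (1 / 2)) (1 / (1 / 2)) x :=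
    ((hasDerivAt_id x).sub_const t).div_const _
  refine ⟨_, ?_, (e.comp x e2).const_mul (1 / 8)⟩
  have := aux_st_deriv ((x - t) / (1 / 2))
  rw [abs_le] at *
  constructor <;> linarith

lemma aux_rho2_deriv (x : ℝ) : |deriv rho2 x| ≤ 1 := by
  obtain ⟨D, hD, h⟩ := aux_scaled_deriv (1 / 2) x
  rw [aux_rho2_eq, h.deriv]; exact hD

lemma aux_rho1_deriv (x : ℝ) : |deriv rho1 x| ≤ 1 := by
  obtain ⟨D, hD, h⟩ := aux_scaled_deriv 0 x
  rw [aux_rho1_eq, (h.const_sub (1 / 8)).deriv, abs_neg]; exact hD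

lemma aux_rho2_bd (x : ℝ) : |rho2 x| ≤ 1 := by
  rw [aux_rho2_eq]
  have h1 := Real.smoothTransition.nonneg ((x - 1 / 2) / (1 / 2))
  have h2 := Real.smoothTransition.le_one ((x - 1 / 2) / (1 / 2))
  rw [abs_le]; constructor <;> dsimp only <;> linarith

lemma aux_rho1_bd (x : ℝ) : |rho1 x| ≤ 1 := by
  rw [aux_rho1_eq]
  have h1 := Real.smoothTransition.nonneg ((x - 0) / (1 / 2))
  have h2 := Real.smoothTransition.le_one ((x - 0) / (1 / 2))
  rw [abs_le]; constructor <;> dsimp only <;> linarith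

lemma aux_rho3_smooth : ContDiff ℝ (⊤ : ℕ∞) rho3 := by
  unfold rho3
  fun_prop

lemma aux_exp_bd (x : ℝ) : (1 + x ^ 2 + x ^ 4 / 2) * Real.exp (-x ^ 2) ≤ 1 := by
  have h := Real.quadratic_le_exp_of_nonneg (sq_nonneg x)
  rw [Real.exp_neg, ← div_eq_mul_inv, div_le_one (Real.exp_pos _)]
  nlinarith

lemma aux_rho3_bd (x : ℝ) : |rho3 x| ≤ 1 := by
  have h := aux_exp_bd x
  have hp := Real.exp_pos (-x ^ 2)
  unfold rho3
  rw [abs_mul, abs_of_pos hp]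
  refine le_trans (mul_le_mul_of_nonneg_right ?_ hp.le) h
  nlinarith [sq_abs x, sq_nonneg (|x| - 1), sq_nonneg (x ^ 2)]

lemma aux_rho3_deriv (x : ℝ) : |deriv rho3 x| ≤ 1 := by
  have h := aux_exp_bd x
  have hp := Real.exp_pos (-x ^ 2)
  have hd : HasDerivAt rho3 (1 * Real.exp (-x ^ 2) + x * (Real.exp (-x ^ 2) * (-(2 * x)))) x := by
    have e : HasDerivAt (fun x : ℝ => -x ^ 2) (-(2 * x)) x := by
      have e0 : HasDerivAt (fun x : ℝ => x ^ 2) (2 * x) x := by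
        simpa using hasDerivAt_pow 2 x
      exact e0.neg
    exact (hasDerivAt_id x).mul e.exp
  rw [hd.deriv]
  have : 1 * Real.exp (-x ^ 2) + x * (Real.exp (-x ^ 2) * (-(2 * x)))
    = (1 - 2 * x ^ 2) * Real.exp (-x ^ 2) := by ring
  rw [this, abs_mul, abs_of_pos hp]
  refine le_trans (mul_le_mul_of_nonneg_right ?_ hp.le) h
  rw [abs_le]
  constructor <;> nlinarith [sq_nonneg (x ^ 2 - 1), sq_nonneg x, sq_nonneg (x ^ 2)]

lemma aux_w_smooth : ContDiff ℝ (⊤ : ℕ∞) (fun x : ℝ => x / (1 + x ^ 2)) := by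
  apply ContDiff.div contDiff_id (by fun_prop)
  intro x; positivity

lemma aux_w_bd (x : ℝ) : |x / (1 + x ^ 2)| ≤ 1 := by
  have : 0 < 1 + x ^ 2 := by positivity
  rw [abs_div, abs_of_pos this, div_le_one this]
  nlinarith [sq_abs x, sq_nonneg (|x| - 1)]

lemma aux_w_deriv (x : ℝ) : |deriv (fun x : ℝ => x / (1 + x ^ 2)) x| ≤ 1 := by
  have hp : 0 < 1 + x ^ 2 := by positivity
  have hd : HasDerivAt (fun x : ℝ => x / (1 + x ^ 2))
      ((1 * (1 + x ^ 2) - x * (2 * x)) / (1 + x ^ 2) ^ 2) x := by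
    have e : HasDerivAt (fun x : ℝ => 1 + x ^ 2) (2 * x) x := by
      simpa using (hasDerivAt_pow 2 x).const_add 1
    exact (hasDerivAt_id x).div e hp.ne'
  rw [hd.deriv, abs_div, abs_of_pos (by positivity : 0 < (1 + x ^ 2) ^ 2),
    div_le_one (by positivity), abs_le]
  constructor <;> nlinarith [sq_nonneg x, sq_nonneg (x ^ 2)]

lemma aux_b_smooth : ContDiff ℝ (⊤ : ℕ∞) bSDE := by
  rw [contDiff_pi]
  intro i
  fin_cases i
  · exact contDiff_const
  · exact aux_rho1_smooth.comp (contDiff_apply ℝ ℝ (3 : Fin 4))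
  · exact contDiff_const
  · exact contDiff_const

lemma aux_a_smooth (h v : ℝ → ℝ) (hh : ContDiff ℝ (⊤ : ℕ∞) h) (hv : ContDiff ℝ (⊤ : ℕ∞) v) :
    ContDiff ℝ (⊤ : ℕ∞) (aSDE h v) := by
  rw [contDiff_pi]
  intro i
  fin_cases i
  · exact (aux_rho2_smooth.comp (contDiff_apply ℝ ℝ (3 : Fin 4))).mul
      (aux_rho3_smooth.comp ((aux_w_smooth.comp (contDiff_apply ℝ ℝ (2 : Fin 4))).mul
        (hv.comp (contDiff_apply ℝ ℝ (1 : Fin 4)))))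
  · exact contDiff_const
  · exact hh.comp (contDiff_apply ℝ ℝ (3 : Fin 4))
  · exact contDiff_const

lemma aux_fderiv_apply (F : (Fin 4 → ℝ) → (Fin 4 → ℝ)) (x e : Fin 4 → ℝ)
    (hF : DifferentiableAt ℝ F x) (i : Fin 4) :
    fderiv ℝ F x e i = fderiv ℝ (fun y => F y i) x e := by
  have := (hasFDerivAt_pi'.1 hF.hasFDerivAt) i
  rw [this.fderiv]; rfl

lemma aux_comp (f : ℝ → ℝ) (hf : ContDiff ℝ (⊤ : ℕ∞) f) (k : Fin 4) (x : Fin 4 → ℝ) :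
    HasFDerivAt (fun y : Fin 4 → ℝ => f (y k))
      (deriv f (x k) • (ContinuousLinearMap.proj k : (Fin 4 → ℝ) →L[ℝ] ℝ)) x := by
  have e : HasDerivAt f (deriv f (x k)) (x k) :=
    (hf.differentiable (by simp) _).hasDerivAt
  exact e.comp_hasFDerivAt x (hasFDerivAt_apply k x)

lemma aux_single (f : ℝ → ℝ) (hf : ContDiff ℝ (⊤ : ℕ∞) f) (k : Fin 4) (x : Fin 4 → ℝ)
    (hb : |deriv f (x k)| ≤ 1) (j : Fin 4) :
    |fderiv ℝ (fun y : Fin 4 → ℝ => f (y k)) x (Pi.single j 1)| ≤ 1 := by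
  rw [(aux_comp f hf k x).fderiv]
  by_cases hjk : k = j
  · subst hjk; simpa using hb
  · simp [Pi.single_apply, hjk]

lemma aux_mul (a b M : ℝ) (ha : |a| ≤ 1) (hb : |b| ≤ M) : |a * b| ≤ M := by
  rw [abs_mul]
  nlinarith [abs_nonneg a, abs_nonneg b]

lemma aux_main (v : ℝ → ℝ) (hv : ContDiff ℝ (⊤ : ℕ∞) v) (x : Fin 4 → ℝ) (M : ℝ) (hM : 1 ≤ M)
    (h1 : |v (x 1)| ≤ M) (h2 : |deriv v (x 1)| ≤ M) (j : Fin 4) :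
    |fderiv ℝ (fun x : Fin 4 → ℝ =>
      rho2 (x 3) * rho3 (x 2 / (1 + (x 2) ^ 2) * v (x 1))) x (Pi.single j 1)| ≤ M := by
  have c1 := aux_comp rho2 aux_rho2_smooth 3 x
  have c2 := aux_comp _ aux_w_smooth 2 x
  have c3 := aux_comp v hv 1 x
  have e3 : HasDerivAt rho3 (deriv rho3 (x 2 / (1 + (x 2) ^ 2) * v (x 1)))
      (x 2 / (1 + (x 2) ^ 2) * v (x 1)) :=
    (aux_rho3_smooth.differentiable (by simp) _).hasDerivAt
  have c4 := e3.comp_hasFDerivAt x (c2.mul c3)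
  have c5 := c1.mul c4
  have c6 := c5.fderiv
  have hr2 := aux_rho2_bd (x 3)
  have hr2' := aux_rho2_deriv (x 3)
  have hr3 := aux_rho3_bd (x 2 / (1 + (x 2) ^ 2) * v (x 1))
  have hr3' := aux_rho3_deriv (x 2 / (1 + (x 2) ^ 2) * v (x 1))
  have hw := aux_w_bd (x 2)
  have hw' := aux_w_deriv (x 2)
  have hMM : (0:ℝ) ≤ M := by linarith
  have hgoal : fderiv ℝ (fun x : Fin 4 → ℝ =>
      rho2 (x 3) * rho3 (x 2 / (1 + (x 2) ^ 2) * v (x 1))) x = _ := c6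
  rw [hgoal]
  clear c6 hgoal c5 c4 c1 c2 c3 e3
  generalize deriv rho3 (x 2 / (1 + (x 2) ^ 2) * v (x 1)) = R3' at *
  generalize deriv (fun x : ℝ => x / (1 + x ^ 2)) (x 2) = W' at *
  fin_cases j
  · simpa using hMM
  · simpa [Pi.single_apply] using aux_mul _ _ _ hr2 (aux_mul _ _ _ hr3' (aux_mul _ _ _ hw h2))
  · have := aux_mul _ _ _ hr2 (aux_mul _ _ _ hr3' (aux_mul _ _ _ hw' h1))
    rw [mul_comm W'] at this
    simpa [Pi.single_apply] using this
  · have := aux_mul _ _ _ hr3 (hr2'.trans hM)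
    simpa [Pi.single_apply] using this

/-- for `u : [0,∞) → [0,∞)` strictly increasing, continuous, with
`liminf_{x→∞} u(x)/x > 0`, for `h ∈ H` and `v ∈ V_u`, the coefficients `a^{h,v}` and
`b` are infinitely differentiable, bounded by one in the maximum norm, all first-order
partial derivatives of `b` are bounded by one, and all first-order partial derivatives
of `a^{h,v}` are bounded by `1 + u(|x|)` (first-order partial derivatives in
direction `j` are encoded as `fderiv ℝ · x (Pi.single j 1)`; the norm on `Fin 4 → ℝ`
is the maximum norm). -/
theorem statement14
    (u : ℝ → ℝ)
    (hmono : StrictMonoOn u (Set.Ici 0)) (hcont : ContinuousOn u (Set.Ici 0))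
    (hnonneg : ∀ y ≥ (0:ℝ), 0 ≤ u y)
    (hliminf : ∃ c > (0:ℝ), ∃ x0 : ℝ, ∀ x ≥ x0, c ≤ u x / x)
    (h : ℝ → ℝ) (hh : h ∈ Hclass) (v : ℝ → ℝ) (hv : v ∈ Vu u) :
    ContDiff ℝ (⊤ : ℕ∞) (aSDE h v) ∧ ContDiff ℝ (⊤ : ℕ∞) bSDE ∧
    (∀ x, ‖aSDE h v x‖ ≤ 1) ∧ (∀ x, ‖bSDE x‖ ≤ 1) ∧
    (∀ (x : Fin 4 → ℝ) (j : Fin 4), ‖fderiv ℝ bSDE x (Pi.single j 1)‖ ≤ 1) ∧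
    (∀ (x : Fin 4 → ℝ) (j : Fin 4),
      ‖fderiv ℝ (aSDE h v) x (Pi.single j 1)‖ ≤ 1 + u ‖x‖) := by
  obtain ⟨hhs, hhb, hhd, -⟩ := hh
  obtain ⟨hvs, hvb⟩ := hv
  have ha := aux_a_smooth h v hhs hvs
  have hb := aux_b_smooth
  refine ⟨ha, hb, ?_, ?_, ?_, ?_⟩
  · intro x
    rw [pi_norm_le_iff_of_nonneg zero_le_one]
    intro i
    fin_cases i
    · exact aux_mul _ _ _ (aux_rho2_bd _) (aux_rho3_bd _)
    · simp [aSDE]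
    · exact hhb _
    · simp [aSDE]
  · intro x
    rw [pi_norm_le_iff_of_nonneg zero_le_one]
    intro i
    fin_cases i
    · simp [bSDE]
    · exact aux_rho1_bd _
    · simp [bSDE]
    · simp [bSDE]
  · intro x j
    rw [pi_norm_le_iff_of_nonneg zero_le_one]
    intro i
    rw [aux_fderiv_apply _ _ _ (hb.differentiable (by simp) x)]
    fin_cases i
    · simp [bSDE]
    · exact aux_single rho1 aux_rho1_smooth 3 x (aux_rho1_deriv _) j
    · simp [bSDE]
    · simp [bSDE]
  · intro x j
    have hu := hnonneg ‖x‖ (norm_nonneg x)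
    have hle : u |x 1| ≤ u ‖x‖ :=
      hmono.monotoneOn (Set.mem_Ici.2 (abs_nonneg _)) (Set.mem_Ici.2 (norm_nonneg x)) (norm_le_pi_norm x 1)
    have hM : 1 ≤ 1 + u ‖x‖ := by linarith
    have hM0 : 0 ≤ 1 + u ‖x‖ := by linarith
    rw [pi_norm_le_iff_of_nonneg hM0]
    intro i
    rw [aux_fderiv_apply _ _ _ (ha.differentiable (by simp) x)]
    fin_cases i
    · exact aux_main v hvs x _ hM ((hvb _).1.trans (by linarith)) ((hvb _).2.trans (by linarith)) j
    · simpa [aSDE] using hM0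
    · exact (aux_single h hhs 3 x (hhd _) j).trans hM
    · simpa [aSDE] using hM0
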